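/- Let K, L be convex bodies with K ∪ L convex, and let x be a boundary point of both K and L at which the centro-affine curvatures κ₀(K,x), κ₀(L,x), κ₀(K∪L,x), κ₀(K∩L,x) all exist and the normal vectors agree. Then κ₀(K∪L,x) = min{κ₀(K,x), κ₀(L,x)} and κ₀(K∩L,x) = max{κ₀(K,x), κ₀(L,x)}. -/

import Mathlib

open Set
open scoped RealInnerProductSpace

/-- `T` (a self-adjoint map fixing the normal `u` and encoding the second fundamental form
on the tangent hyperplane) is an Aleksandrov second-order expansion of the convex body `K`
at the boundary point `x` with exterior unit normal `u`:  near `x`, the distance of boundary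
points `y` from the tangent hyperplane is `⟪T(y-x), y-x⟫/2 + o(‖y-x‖²)`.  The generalized
Gaussian curvature of `K` at `x` is then `κ(K,x) = det T`, and the centro-affine curvature
is `κ₀(K,x) = det T / ⟪x,u⟫^(n+1)`. -/
def HasExpansionAt {n : ℕ} (K : Set (EuclideanSpace ℝ (Fin n)))
    (x u : EuclideanSpace ℝ (Fin n))
    (T : EuclideanSpace ℝ (Fin n) →ₗ[ℝ] EuclideanSpace ℝ (Fin n)) : Prop :=
  x ∈ frontier K ∧ (∀ y ∈ K, ⟪u, y - x⟫ ≤ 0) ∧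
  T u = u ∧ (∀ v w, ⟪T v, w⟫ = ⟪v, T w⟫) ∧ (∀ v, 0 ≤ ⟪T v, v⟫) ∧
  ∀ ε > 0, ∃ δ > 0, ∀ y ∈ frontier K, ‖y - x‖ < δ →
    |⟪u, x - y⟫ - ⟪T (y - x), y - x⟫ / 2| ≤ ε * ‖y - x‖ ^ 2

section Helpers

open Filter Topology

lemma cmm_det_one_add_ge {m : ℕ} {P : Matrix (Fin m) (Fin m) ℝ} (hP : P.PosSemidef) :
    1 ≤ (1 + P).det := by
  have hM : (1 + P).PosSemidef := Matrix.PosSemidef.one.add hP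
  have h := congrArg (Polynomial.eval (-1)) hP.1.charpoly_eq
  rw [Matrix.eval_charpoly, Polynomial.eval_prod] at h
  have e : (Matrix.scalar (Fin m) (-1 : ℝ) - P) = -(1 + P) := by
    rw [map_neg, map_one]; abel
  rw [e, Matrix.det_neg] at h
  have e2 : ∏ i, Polynomial.eval (-1) (Polynomial.X - Polynomial.C ((hP.1.eigenvalues i : ℝ)))
      = (-1) ^ Fintype.card (Fin m) * ∏ i, (1 + hP.1.eigenvalues i) := by
    rw [← Finset.card_univ, ← Finset.prod_const, ← Finset.prod_mul_distrib]
    refine Finset.prod_congr rfl fun i _ => ?_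
    simp; ring
  have h' : (1 + P).det = ∏ i, (1 + hP.1.eigenvalues i) := by
    have h3 := h.trans e2
    exact mul_left_cancel₀ (by simp) h3
  rw [h']
  calc (1 : ℝ) = ∏ i : Fin m, (1 : ℝ) := by simp
    _ ≤ _ := Finset.prod_le_prod (by simp) fun i _ => by
      have := hP.eigenvalues_nonneg i
      linarith

open scoped MatrixOrder in
lemma cmm_det_mono_matrix {m : ℕ} {A D : Matrix (Fin m) (Fin m) ℝ} (hA : A.PosSemidef)
    (hD : D.PosSemidef) : A.det ≤ (A + D).det := by
  by_cases h0 : A.det = 0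
  · rw [h0]; exact (hA.add hD).det_nonneg
  obtain ⟨C, hC⟩ := CStarAlgebra.nonneg_iff_eq_star_mul_self.mp hA.nonneg
  rw [Matrix.star_eq_conjTranspose] at hC
  have hdC : IsUnit C.det := by
    rw [isUnit_iff_ne_zero]
    intro h
    apply h0
    rw [hC, Matrix.det_mul, h, mul_zero]
  have hdCt : IsUnit (C.conjTranspose).det := by
    rw [Matrix.det_conjTranspose]; exact hdC.star
  have hP := hD.conjTranspose_mul_mul_same (C⁻¹)
  have key : A + D = C.conjTranspose * (1 + (C⁻¹).conjTranspose * D * C⁻¹) * C := by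
    rw [mul_add, add_mul, mul_one, ← hC, Matrix.conjTranspose_nonsing_inv]
    congr 1
    rw [← Matrix.mul_assoc, ← Matrix.mul_assoc, Matrix.mul_nonsing_inv _ hdCt, one_mul,
      Matrix.mul_assoc, Matrix.nonsing_inv_mul _ hdC, mul_one]
  have h1 := cmm_det_one_add_ge hP
  have h2 : A.det = C.conjTranspose.det * C.det := by rw [hC, Matrix.det_mul]
  have h3 := hA.det_nonneg
  rw [key, Matrix.det_mul, Matrix.det_mul]
  calc A.det = A.det * 1 := by ring
    _ ≤ A.det * _ := mul_le_mul_of_nonneg_left h1 h3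
    _ = _ := by rw [h2]; ring

lemma cmm_det_mono {n : ℕ}
    {S T : EuclideanSpace ℝ (Fin n) →ₗ[ℝ] EuclideanSpace ℝ (Fin n)}
    (hS : S.IsPositive) (hT : (T - S).IsPositive) : LinearMap.det S ≤ LinearMap.det T := by
  let b := EuclideanSpace.basisFun (Fin n) ℝ
  rw [← LinearMap.det_toMatrix b.toBasis S, ← LinearMap.det_toMatrix b.toBasis T]
  have h := cmm_det_mono_matrix ((LinearMap.posSemidef_toMatrix_iff b).2 hS)
    ((LinearMap.posSemidef_toMatrix_iff b).2 hT)
  rw [← map_add, add_sub_cancel] at h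
  exact h

lemma cmm_ker {n : ℕ} {D : EuclideanSpace ℝ (Fin n) →ₗ[ℝ] EuclideanSpace ℝ (Fin n)}
    (hs : ∀ v w, ⟪D v, w⟫ = ⟪v, D w⟫) (hp : ∀ v, 0 ≤ ⟪D v, v⟫) {v : EuclideanSpace ℝ (Fin n)}
    (hv : ⟪D v, v⟫ = 0) : D v = 0 := by
  have key : ∀ t : ℝ, 0 ≤ 2 * t * ⟪D v, D v⟫ + t ^ 2 * ⟪D (D v), D v⟫ := by
    intro t
    have h := hp (v + t • D v)
    have e : ⟪D (D v), v⟫ = ⟪D v, D v⟫ := hs _ _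
    simp only [map_add, map_smul, inner_add_left, inner_add_right, inner_smul_left,
      inner_smul_right, hv, e] at h
    simp at h
    simp
    nlinarith
  have hB := hp (D v)
  have hA : 0 ≤ ⟪D v, D v⟫ := real_inner_self_nonneg
  rw [← inner_self_eq_zero (𝕜 := ℝ)]
  set A := ⟪D v, D v⟫
  set B := ⟪D (D v), D v⟫
  by_contra hne
  have hApos : 0 < A := lt_of_le_of_ne hA (Ne.symm hne)
  have h := key (-(A / (B + 1)))
  have hB1 : 0 < B + 1 := by linarith
  have e : 2 * (-(A / (B + 1))) * A + (-(A / (B + 1))) ^ 2 * B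
      = -(A ^ 2 * (B + 2) / (B + 1) ^ 2) := by
    field_simp; ring
  rw [e] at h
  have : 0 < A ^ 2 * (B + 2) / (B + 1) ^ 2 := by positivity
  linarith

/-- Two positive forms whose pointwise product vanishes: one of them is zero. -/
lemma cmm_union {n : ℕ} {D E : EuclideanSpace ℝ (Fin n) →ₗ[ℝ] EuclideanSpace ℝ (Fin n)}
    (hDs : ∀ v w, ⟪D v, w⟫ = ⟪v, D w⟫) (hDp : ∀ v, 0 ≤ ⟪D v, v⟫)
    (hEs : ∀ v w, ⟪E v, w⟫ = ⟪v, E w⟫) (hEp : ∀ v, 0 ≤ ⟪E v, v⟫)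
    (h : ∀ v, ⟪D v, v⟫ = 0 ∨ ⟪E v, v⟫ = 0) : D = 0 ∨ E = 0 := by
  have h' : ∀ v, D v = 0 ∨ E v = 0 := fun v =>
    (h v).imp (cmm_ker hDs hDp) (cmm_ker hEs hEp)
  by_contra hcon
  push Not at hcon
  obtain ⟨hD, hE⟩ := hcon
  obtain ⟨v, hv⟩ : ∃ v, D v ≠ 0 := by
    by_contra hc; push Not at hc; exact hD (LinearMap.ext hc)
  obtain ⟨w, hw⟩ : ∃ w, E w ≠ 0 := by
    by_contra hc; push Not at hc; exact hE (LinearMap.ext hc)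
  have hv' := (h' v).resolve_left hv
  have hw' := (h' w).resolve_right hw
  rcases h' (v + w) with h1 | h1
  · rw [map_add, hw', add_zero] at h1; exact hv h1
  · rw [map_add, hv', zero_add] at h1; exact hw h1

lemma cmm_pos {n : ℕ} {K : Set (EuclideanSpace ℝ (Fin n))} {x u : EuclideanSpace ℝ (Fin n)}
    (hu : ‖u‖ = 1) (hK0 : (0 : EuclideanSpace ℝ (Fin n)) ∈ interior K)
    (h : ∀ y ∈ K, ⟪u, y - x⟫ ≤ 0) : 0 < ⟪u, x⟫ := by
  obtain ⟨r, hr, hb⟩ := Metric.mem_nhds_iff.1 (mem_interior_iff_mem_nhds.1 hK0)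
  have hm : (r / 2) • u ∈ K := hb (by
    rw [mem_ball_zero_iff, norm_smul, hu, Real.norm_eq_abs, abs_of_pos (by linarith)]; linarith)
  have h1 := h _ hm
  rw [inner_sub_right, inner_smul_right, real_inner_self_eq_norm_sq, hu] at h1
  linarith

/-- The second-order expansion in terms of the gauge along tangent directions. -/
lemma cmm_limit {n : ℕ} {K : Set (EuclideanSpace ℝ (Fin n))} {x u : EuclideanSpace ℝ (Fin n)}
    {T : EuclideanSpace ℝ (Fin n) →ₗ[ℝ] EuclideanSpace ℝ (Fin n)}
    (hKcl : IsClosed K) (hKconv : Convex ℝ K) (hK0 : K ∈ 𝓝 (0 : EuclideanSpace ℝ (Fin n)))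
    (ha : 0 < ⟪u, x⟫) (hT : HasExpansionAt K x u T)
    {v : EuclideanSpace ℝ (Fin n)} (hv : ⟪u, v⟫ = 0) :
    Tendsto (fun s : ℝ => gauge K (x + s • v)) (𝓝[>] 0) (𝓝 1) ∧
    Tendsto (fun s : ℝ => (gauge K (x + s • v) - 1) / s ^ 2) (𝓝[>] 0)
      (𝓝 (⟪T v, v⟫ / 2 / ⟪u, x⟫)) := by
  obtain ⟨hxf, hsup, -, hTs, hTp, hexp⟩ := hT
  have hTc : Continuous T := T.continuous_of_finiteDimensional
  set a := ⟪u, x⟫ with ha_def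
  set g : ℝ → ℝ := fun s => gauge K (x + s • v) with hg_def
  set l : Filter ℝ := 𝓝[>] 0 with hl
  have hs0 : Tendsto (fun s : ℝ => s) l (𝓝 0) := tendsto_id.mono_left nhdsWithin_le_nhds
  have hspos : ∀ᶠ s in l, 0 < s := self_mem_nhdsWithin
  have hz : Tendsto (fun s : ℝ => x + s • v) l (𝓝 x) := by
    have := (tendsto_const_nhds (x := x)).add (hs0.smul_const v)
    simpa using this
  have hgx : gauge K x = 1 := (gauge_eq_one_iff_mem_frontier hKconv hK0).2 hxf
  have hg : Tendsto g l (𝓝 1) := by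
    rw [← hgx]
    exact ((continuous_gauge hKconv hK0).tendsto x).comp hz
  refine ⟨hg, ?_⟩
  have hgpos : ∀ᶠ s in l, 0 < g s := hg.eventually (lt_mem_nhds one_pos)
  have hy : Tendsto (fun s => (g s)⁻¹ • (x + s • v)) l (𝓝 x) := by
    have := (hg.inv₀ one_ne_zero).smul hz
    simpa using this
  have hyf : ∀ᶠ s in l, (g s)⁻¹ • (x + s • v) ∈ frontier K := by
    filter_upwards [hgpos] with s hs
    rw [← gauge_eq_one_iff_mem_frontier hKconv hK0, gauge_smul_of_nonneg (by positivity)]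
    exact inv_mul_cancel₀ hs.ne'
  have huy : ∀ s, 0 < g s → ⟪u, x - (g s)⁻¹ • (x + s • v)⟫ = a * (g s - 1) / g s := by
    intro s hs
    rw [inner_sub_right, inner_smul_right, inner_add_right, inner_smul_right, hv, ← ha_def]
    field_simp; ring
  have hge : ∀ᶠ s in l, 1 ≤ g s := by
    filter_upwards [hgpos, hyf] with s hs hf
    have h1 := hsup _ (hKcl.frontier_subset hf)
    rw [← neg_sub, inner_neg_right, huy s hs] at h1
    have h2 : 0 ≤ a * (g s - 1) / g s := by linarith
    by_contra hlt
    push Not at hlt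
    have : a * (g s - 1) / g s < 0 := div_neg_of_neg_of_pos (by nlinarith) hs
    linarith
  have step1 : ∀ ε > 0, ∀ᶠ s in l,
      |a * (g s - 1) * g s - ⟪T (s • v - (g s - 1) • x), s • v - (g s - 1) • x⟫ / 2|
        ≤ ε * ‖s • v - (g s - 1) • x‖ ^ 2 := by
    intro ε hε
    obtain ⟨δ, hδ, hd⟩ := hexp ε hε
    have hnear : ∀ᶠ s in l, ‖(g s)⁻¹ • (x + s • v) - x‖ < δ := by
      have := hy.eventually (Metric.ball_mem_nhds x hδ)
      filter_upwards [this] with s hs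
      rwa [← dist_eq_norm]
    filter_upwards [hgpos, hyf, hnear] with s hs hf hn
    have h1 := hd _ hf hn
    rw [huy s hs] at h1
    have e : (g s)⁻¹ • (x + s • v) - x = (g s)⁻¹ • (s • v - (g s - 1) • x) := by
      have : x = (g s)⁻¹ • (g s • x) := by rw [smul_smul, inv_mul_cancel₀ hs.ne', one_smul]
      nth_rewrite 2 [this]
      rw [← smul_sub, sub_smul, one_smul]
      congr 1; abel
    rw [e, map_smul, inner_smul_left, inner_smul_right, norm_smul] at h1
    set w := s • v - (g s - 1) • x
    simp only [conj_trivial, norm_inv, Real.norm_eq_abs, abs_of_pos hs] at h1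
    have e1 : a * (g s - 1) / g s - (g s)⁻¹ * ((g s)⁻¹ * ⟪T w, w⟫) / 2
        = (a * (g s - 1) * g s - ⟪T w, w⟫ / 2) / (g s) ^ 2 := by
      field_simp
    have e2 : ε * ((g s)⁻¹ * ‖w‖) ^ 2 = (ε * ‖w‖ ^ 2) / (g s) ^ 2 := by
      field_simp
    rw [e1, e2, abs_div, abs_of_pos (by positivity : 0 < g s ^ 2)] at h1
    exact (div_le_div_iff_of_pos_right (by positivity)).1 h1
  -- `h = O(s²)`
  obtain ⟨C, hC0, hC⟩ : ∃ C : ℝ, 0 ≤ C ∧ ∀ w, ⟪T w, w⟫ ≤ C * ‖w‖ ^ 2 := by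
    refine ⟨‖LinearMap.toContinuousLinearMap T‖, norm_nonneg _, fun w => ?_⟩
    calc ⟪T w, w⟫ ≤ ‖T w‖ * ‖w‖ := real_inner_le_norm _ _
      _ ≤ (‖LinearMap.toContinuousLinearMap T‖ * ‖w‖) * ‖w‖ := by
        gcongr
        exact (LinearMap.toContinuousLinearMap T).le_opNorm w
      _ = _ := by ring
  have hh0 : Tendsto (fun s => g s - 1) l (𝓝 0) := by
    simpa using hg.sub_const 1
  have hr : Tendsto (fun s => (g s - 1) / s) l (𝓝 0) := by
    set M := 2 * (C / 2 + 1) with hM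
    have hM0 : 0 < M := by positivity
    have hsmall : ∀ᶠ s in l, (g s - 1) * (M * ‖x‖ ^ 2) < a / 2 := by
      have : Tendsto (fun s => (g s - 1) * (M * ‖x‖ ^ 2)) l (𝓝 0) := by
        simpa using hh0.mul_const (M * ‖x‖ ^ 2)
      exact this.eventually (gt_mem_nhds (by positivity))
    have hub : Tendsto (fun s : ℝ => (2 * M * ‖v‖ ^ 2 / a) * s) l (𝓝 0) := by
      simpa using hs0.const_mul (2 * M * ‖v‖ ^ 2 / a)
    refine tendsto_of_tendsto_of_tendsto_of_le_of_le' tendsto_const_nhds hub ?_ ?_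
    · filter_upwards [hspos, hge] with s hs h1
      exact div_nonneg (by linarith) hs.le
    · filter_upwards [hspos, hge, hsmall, step1 1 one_pos] with s hs h1 h2 h3
      have hwn : ‖s • v - (g s - 1) • x‖ ^ 2 ≤ 2 * (s ^ 2 * ‖v‖ ^ 2 + (g s - 1) ^ 2 * ‖x‖ ^ 2) := by
        have b := norm_sub_le (s • v) ((g s - 1) • x)
        rw [norm_smul, norm_smul, Real.norm_eq_abs, Real.norm_eq_abs, abs_of_pos hs,
          abs_of_nonneg (by linarith : 0 ≤ g s - 1)] at b
        have b0 := norm_nonneg (s • v - (g s - 1) • x)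
        nlinarith [sq_nonneg (s * ‖v‖ - (g s - 1) * ‖x‖), pow_le_pow_left₀ b0 b 2]
      have h4 := (abs_le.1 h3).2
      have h5 := hC (s • v - (g s - 1) • x)
      set W := ‖s • v - (g s - 1) • x‖ ^ 2
      have h6 : a * (g s - 1) * g s ≤ (C / 2 + 1) * W := by linarith
      have h7 : (C / 2 + 1) * W ≤ M * (s ^ 2 * ‖v‖ ^ 2 + (g s - 1) ^ 2 * ‖x‖ ^ 2) := by
        have := mul_le_mul_of_nonneg_left hwn (by positivity : 0 ≤ C / 2 + 1)
        rw [hM]; linarith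
      have h8 : a * (g s - 1) ≤ a * (g s - 1) * g s :=
        le_mul_of_one_le_right (mul_nonneg ha.le (by linarith)) h1
      have h9 : (g s - 1) * ((g s - 1) * (M * ‖x‖ ^ 2)) ≤ (g s - 1) * (a / 2) :=
        mul_le_mul_of_nonneg_left h2.le (by linarith)
      have h10 : a * (g s - 1) ≤ 2 * M * ‖v‖ ^ 2 * s ^ 2 := by nlinarith
      rw [div_le_iff₀ hs]
      have e : 2 * M * ‖v‖ ^ 2 / a * s * s = 2 * M * ‖v‖ ^ 2 * s ^ 2 / a := by ring
      rw [e, le_div_iff₀ ha]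
      linarith
  have hw : Tendsto (fun s => v - ((g s - 1) / s) • x) l (𝓝 v) := by
    simpa using (tendsto_const_nhds (x := v)).sub (hr.smul_const x)
  have hQ : Tendsto (fun s => ⟪T (v - ((g s - 1) / s) • x), v - ((g s - 1) / s) • x⟫ / 2) l
      (𝓝 (⟪T v, v⟫ / 2)) :=
    (((hTc.tendsto v).comp hw).inner hw).div_const 2
  have step3 : Tendsto (fun s => a * ((g s - 1) / s ^ 2) * g s
      - ⟪T (v - ((g s - 1) / s) • x), v - ((g s - 1) / s) • x⟫ / 2) l (𝓝 0) := by
    rw [Metric.tendsto_nhds]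
    intro η hη
    have hn : ∀ᶠ s in l, ‖v - ((g s - 1) / s) • x‖ ^ 2 < ‖v‖ ^ 2 + 1 :=
      (hw.norm.pow 2).eventually (gt_mem_nhds (by linarith))
    have hη' : 0 < η / (‖v‖ ^ 2 + 1) := by positivity
    filter_upwards [hspos, hn, step1 _ hη'] with s hs h1 h2
    have e : s • v - (g s - 1) • x = s • (v - ((g s - 1) / s) • x) := by
      rw [smul_sub, smul_smul, mul_div_cancel₀ _ hs.ne']
    rw [e, map_smul, inner_smul_left, inner_smul_right, norm_smul] at h2
    set w := v - ((g s - 1) / s) • x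
    simp only [conj_trivial, Real.norm_eq_abs, abs_of_pos hs] at h2
    have e1 : a * (g s - 1) * g s - s * (s * ⟪T w, w⟫) / 2
        = s ^ 2 * (a * ((g s - 1) / s ^ 2) * g s - ⟪T w, w⟫ / 2) := by
      field_simp
    rw [e1, abs_mul, abs_of_pos (by positivity : 0 < s ^ 2)] at h2
    have h3 : |a * ((g s - 1) / s ^ 2) * g s - ⟪T w, w⟫ / 2|
        ≤ η / (‖v‖ ^ 2 + 1) * ‖w‖ ^ 2 := by
      refine le_of_mul_le_mul_left ?_ (by positivity : 0 < s ^ 2)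
      calc _ ≤ _ := h2
        _ = _ := by ring
    rw [Real.dist_eq, sub_zero]
    calc _ ≤ _ := h3
      _ < η / (‖v‖ ^ 2 + 1) * (‖v‖ ^ 2 + 1) := mul_lt_mul_of_pos_left h1 hη'
      _ = η := by field_simp
  have step4 : Tendsto (fun s => a * ((g s - 1) / s ^ 2) * g s) l (𝓝 (⟪T v, v⟫ / 2)) := by
    have := step3.add hQ
    simpa using this
  have step5 := step4.div (hg.const_mul a) (by simpa using ha.ne')
  rw [mul_one] at step5
  refine step5.congr' ?_
  filter_upwards [hgpos] with s hs
  simp only [Pi.div_apply]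
  change _ = (g s - 1) / s ^ 2
  field_simp

lemma cmm_gauge_union {n : ℕ} {K L : Set (EuclideanSpace ℝ (Fin n))}
    (hKcl : IsClosed K) (hLcl : IsClosed L)
    (hK0 : K ∈ 𝓝 (0 : EuclideanSpace ℝ (Fin n))) (hL0 : L ∈ 𝓝 (0 : EuclideanSpace ℝ (Fin n)))
    (hUL : Convex ℝ (K ∪ L)) {z : EuclideanSpace ℝ (Fin n)} (hz : 0 < gauge (K ∪ L) z) :
    gauge (K ∪ L) z = min (gauge K z) (gauge L z) := by
  have hU0 : K ∪ L ∈ 𝓝 (0 : EuclideanSpace ℝ (Fin n)) := mem_of_superset hK0 subset_union_left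
  apply le_antisymm
  · exact le_min (gauge_mono (absorbent_nhds_zero hK0) subset_union_left z)
      (gauge_mono (absorbent_nhds_zero hL0) subset_union_right z)
  · set c := gauge (K ∪ L) z
    have h1 : c⁻¹ • z ∈ K ∪ L := by
      rw [← (hKcl.union hLcl).closure_eq, ← gauge_le_one_iff_mem_closure hUL hU0,
        gauge_smul_of_nonneg (by positivity)]
      exact (inv_mul_cancel₀ hz.ne').le
    have aux : ∀ S : Set (EuclideanSpace ℝ (Fin n)), c⁻¹ • z ∈ S → gauge S z ≤ c := by
      intro S hS
      have h2 := gauge_le_one_of_mem hS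
      rw [gauge_smul_of_nonneg (by positivity), smul_eq_mul, inv_mul_le_iff₀ hz] at h2
      linarith
    rcases h1 with h1 | h1
    · exact min_le_of_left_le (aux K h1)
    · exact min_le_of_right_le (aux L h1)

lemma cmm_gauge_inter {n : ℕ} {K L : Set (EuclideanSpace ℝ (Fin n))}
    (hKcl : IsClosed K) (hLcl : IsClosed L) (hKconv : Convex ℝ K) (hLconv : Convex ℝ L)
    (hK0 : K ∈ 𝓝 (0 : EuclideanSpace ℝ (Fin n))) (hL0 : L ∈ 𝓝 (0 : EuclideanSpace ℝ (Fin n)))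
    {z : EuclideanSpace ℝ (Fin n)} (hz : 0 < gauge K z) :
    gauge (K ∩ L) z = max (gauge K z) (gauge L z) := by
  have hI0 : K ∩ L ∈ 𝓝 (0 : EuclideanSpace ℝ (Fin n)) := inter_mem hK0 hL0
  apply le_antisymm
  · set c := max (gauge K z) (gauge L z) with hc
    have hcpos : 0 < c := lt_max_of_lt_left hz
    have aux : ∀ S : Set (EuclideanSpace ℝ (Fin n)), IsClosed S → Convex ℝ S → S ∈ 𝓝 0 →
        gauge S z ≤ c → c⁻¹ • z ∈ S := by
      intro S hS hSc hS0 h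
      rw [← hS.closure_eq, ← gauge_le_one_iff_mem_closure hSc hS0,
        gauge_smul_of_nonneg (by positivity), smul_eq_mul, inv_mul_le_iff₀ hcpos]
      linarith
    have h1 : c⁻¹ • z ∈ K ∩ L :=
      ⟨aux K hKcl hKconv hK0 (le_max_left _ _), aux L hLcl hLconv hL0 (le_max_right _ _)⟩
    have h2 := gauge_le_one_of_mem h1
    rw [gauge_smul_of_nonneg (by positivity), smul_eq_mul, inv_mul_le_iff₀ hcpos] at h2
    linarith
  · exact max_le (gauge_mono (absorbent_nhds_zero hI0) inter_subset_left z)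
      (gauge_mono (absorbent_nhds_zero hI0) inter_subset_right z)

lemma cmm_quad_split {n : ℕ} {u : EuclideanSpace ℝ (Fin n)} (hu : ‖u‖ = 1)
    {T : EuclideanSpace ℝ (Fin n) →ₗ[ℝ] EuclideanSpace ℝ (Fin n)}
    (hTu : T u = u) (hTs : ∀ v w, ⟪T v, w⟫ = ⟪v, T w⟫)
    (v : EuclideanSpace ℝ (Fin n)) :
    ⟪T v, v⟫ = ⟪T (v - ⟪u, v⟫ • u), v - ⟪u, v⟫ • u⟫ + ⟪u, v⟫ ^ 2 := by
  have h1 : ⟪T v, u⟫ = ⟪u, v⟫ := by rw [hTs, hTu, real_inner_comm]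
  have h2 : ⟪u, u⟫ = (1 : ℝ) := by rw [real_inner_self_eq_norm_sq, hu]; norm_num
  simp only [map_sub, map_smul, hTu, inner_sub_left, inner_sub_right, inner_smul_left,
    inner_smul_right, h1, h2, conj_trivial]
  ring

/-- Linear-algebra conclusion, in the case `T₃ = T₁`. -/
lemma cmm_case {n : ℕ} {T₁ T₂ T₃ T₄ : EuclideanSpace ℝ (Fin n) →ₗ[ℝ] EuclideanSpace ℝ (Fin n)}
    (s₁ : ∀ v w, ⟪T₁ v, w⟫ = ⟪v, T₁ w⟫) (p₁ : ∀ v, 0 ≤ ⟪T₁ v, v⟫)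
    (s₂ : ∀ v w, ⟪T₂ v, w⟫ = ⟪v, T₂ w⟫)
    (s₄ : ∀ v w, ⟪T₄ v, w⟫ = ⟪v, T₄ w⟫)
    (hmin : ∀ v, ⟪T₃ v, v⟫ = min ⟪T₁ v, v⟫ ⟪T₂ v, v⟫)
    (hmax : ∀ v, ⟪T₄ v, v⟫ = max ⟪T₁ v, v⟫ ⟪T₂ v, v⟫) (h : T₃ = T₁) :
    T₄ = T₂ ∧ LinearMap.det T₁ ≤ LinearMap.det T₂ := by
  have hle : ∀ v, ⟪T₁ v, v⟫ ≤ ⟪T₂ v, v⟫ := by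
    intro v
    have h1 := hmin v
    rw [h] at h1
    rw [h1]; exact min_le_right _ _
  constructor
  · have hsym : ∀ v w, ⟪(T₄ - T₂) v, w⟫ = ⟪v, (T₄ - T₂) w⟫ := by
      intro v w
      simp only [LinearMap.sub_apply, inner_sub_left, inner_sub_right, s₄ v w, s₂ v w]
    have hz : ∀ v, ⟪(T₄ - T₂) v, v⟫ = 0 := by
      intro v
      rw [LinearMap.sub_apply, inner_sub_left, hmax v, max_eq_right (hle v), sub_self]
    rw [← sub_eq_zero]
    exact LinearMap.ext fun v => cmm_ker hsym (fun v => (hz v).ge) (hz v)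
  · apply cmm_det_mono
    · exact ⟨s₁, fun v => by simpa using p₁ v⟩
    · refine ⟨fun v w => ?_, fun v => ?_⟩
      · simp only [LinearMap.sub_apply, inner_sub_left, inner_sub_right, s₁ v w, s₂ v w]
      · simpa [inner_sub_left] using hle v

end Helpers

/-- if `x` is a common boundary point of `K`, `L`, `K ∪ L` (convex), `K ∩ L`
with common exterior unit normal `u`, at which all four centro-affine curvatures exist, then
`κ₀(K∪L,x) = min{κ₀(K,x), κ₀(L,x)}` and `κ₀(K∩L,x) = max{κ₀(K,x), κ₀(L,x)}`. -/
theorem curvature_min_max {n : ℕ} (hn : 0 < n)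
    (K L : Set (EuclideanSpace ℝ (Fin n)))
    (hKc : IsCompact K) (hKconv : Convex ℝ K)
    (hK0 : (0 : EuclideanSpace ℝ (Fin n)) ∈ interior K)
    (hLc : IsCompact L) (hLconv : Convex ℝ L)
    (hL0 : (0 : EuclideanSpace ℝ (Fin n)) ∈ interior L)
    (hUL : Convex ℝ (K ∪ L))
    (x u : EuclideanSpace ℝ (Fin n)) (hu : ‖u‖ = 1)
    (T₁ T₂ T₃ T₄ : EuclideanSpace ℝ (Fin n) →ₗ[ℝ] EuclideanSpace ℝ (Fin n))
    (h₁ : HasExpansionAt K x u T₁) (h₂ : HasExpansionAt L x u T₂)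
    (h₃ : HasExpansionAt (K ∪ L) x u T₃) (h₄ : HasExpansionAt (K ∩ L) x u T₄) :
    LinearMap.det T₃ / ⟪x, u⟫ ^ (n + 1) =
        min (LinearMap.det T₁ / ⟪x, u⟫ ^ (n + 1)) (LinearMap.det T₂ / ⟪x, u⟫ ^ (n + 1)) ∧
    LinearMap.det T₄ / ⟪x, u⟫ ^ (n + 1) =
        max (LinearMap.det T₁ / ⟪x, u⟫ ^ (n + 1)) (LinearMap.det T₂ / ⟪x, u⟫ ^ (n + 1)) := by
  have hK0' := mem_interior_iff_mem_nhds.1 hK0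
  have hL0' := mem_interior_iff_mem_nhds.1 hL0
  have hKcl := hKc.isClosed
  have hLcl := hLc.isClosed
  have ha : 0 < ⟪u, x⟫ := cmm_pos hu hK0 h₁.2.1
  have hperp : ∀ v : EuclideanSpace ℝ (Fin n), ⟪u, v⟫ = 0 →
      ⟪T₃ v, v⟫ = min ⟪T₁ v, v⟫ ⟪T₂ v, v⟫ ∧ ⟪T₄ v, v⟫ = max ⟪T₁ v, v⟫ ⟪T₂ v, v⟫ := by
    intro v hv
    obtain ⟨g1, l1⟩ := cmm_limit hKcl hKconv hK0' ha h₁ hv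
    obtain ⟨g2, l2⟩ := cmm_limit hLcl hLconv hL0' ha h₂ hv
    obtain ⟨g3, l3⟩ := cmm_limit (hKcl.union hLcl) hUL
      (Filter.mem_of_superset hK0' subset_union_left) ha h₃ hv
    obtain ⟨g4, l4⟩ := cmm_limit (hKcl.inter hLcl) (hKconv.inter hLconv)
      (Filter.inter_mem hK0' hL0') ha h₄ hv
    have p1 := g1.eventually (lt_mem_nhds one_pos)
    have p3 := g3.eventually (lt_mem_nhds one_pos)
    have scale : ∀ p q r : ℝ, p / 2 / ⟪u, x⟫ = min (q / 2 / ⟪u, x⟫) (r / 2 / ⟪u, x⟫) →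
        p = min q r := by
      intro p q r h
      rw [min_div_div_right ha.le, min_div_div_right (by norm_num : (0 : ℝ) ≤ 2)] at h
      have h := (div_left_inj' ha.ne').1 h
      exact (div_left_inj' two_ne_zero).1 h
    have scale' : ∀ p q r : ℝ, p / 2 / ⟪u, x⟫ = max (q / 2 / ⟪u, x⟫) (r / 2 / ⟪u, x⟫) →
        p = max q r := by
      intro p q r h
      rw [max_div_div_right ha.le, max_div_div_right (by norm_num : (0 : ℝ) ≤ 2)] at h
      have h := (div_left_inj' ha.ne').1 h
      exact (div_left_inj' two_ne_zero).1 h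
    constructor
    · apply scale
      refine tendsto_nhds_unique l3 ((l1.min l2).congr' ?_)
      filter_upwards [p3] with s hs
      rw [cmm_gauge_union hKcl hLcl hK0' hL0' hUL hs, min_div_div_right (by positivity),
        min_sub_sub_right]
    · apply scale'
      refine tendsto_nhds_unique l4 ((l1.max l2).congr' ?_)
      filter_upwards [p1] with s hs
      rw [cmm_gauge_inter hKcl hLcl hKconv hLconv hK0' hL0' hs, max_div_div_right (by positivity),
        max_sub_sub_right]
  obtain ⟨-, -, u₁, s₁, p₁, -⟩ := h₁
  obtain ⟨-, -, u₂, s₂, p₂, -⟩ := h₂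
  obtain ⟨-, -, u₃, s₃, p₃, -⟩ := h₃
  obtain ⟨-, -, u₄, s₄, p₄, -⟩ := h₄
  have hproj : ∀ v : EuclideanSpace ℝ (Fin n), ⟪u, v - ⟪u, v⟫ • u⟫ = 0 := by
    intro v
    rw [inner_sub_right, inner_smul_right, real_inner_self_eq_norm_sq, hu]
    ring
  have hmin : ∀ v, ⟪T₃ v, v⟫ = min ⟪T₁ v, v⟫ ⟪T₂ v, v⟫ := by
    intro v
    rw [cmm_quad_split hu u₁ s₁ v, cmm_quad_split hu u₂ s₂ v, cmm_quad_split hu u₃ s₃ v,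
      (hperp _ (hproj v)).1, min_add_add_right]
  have hmax : ∀ v, ⟪T₄ v, v⟫ = max ⟪T₁ v, v⟫ ⟪T₂ v, v⟫ := by
    intro v
    rw [cmm_quad_split hu u₁ s₁ v, cmm_quad_split hu u₂ s₂ v, cmm_quad_split hu u₄ s₄ v,
      (hperp _ (hproj v)).2, max_add_add_right]
  have hc : 0 ≤ ⟪x, u⟫ ^ (n + 1) := by
    rw [real_inner_comm]; positivity
  rw [min_div_div_right hc, max_div_div_right hc]
  have hcases : T₁ - T₃ = 0 ∨ T₂ - T₃ = 0 := by
    apply cmm_union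
    · intro v w
      simp only [LinearMap.sub_apply, inner_sub_left, inner_sub_right, s₁ v w, s₃ v w]
    · intro v
      rw [LinearMap.sub_apply, inner_sub_left, hmin v]
      exact sub_nonneg.2 (min_le_left _ _)
    · intro v w
      simp only [LinearMap.sub_apply, inner_sub_left, inner_sub_right, s₂ v w, s₃ v w]
    · intro v
      rw [LinearMap.sub_apply, inner_sub_left, hmin v]
      exact sub_nonneg.2 (min_le_right _ _)
    · intro v
      rw [LinearMap.sub_apply, LinearMap.sub_apply, inner_sub_left, inner_sub_left, hmin v]
      rcases min_choice ⟪T₁ v, v⟫ ⟪T₂ v, v⟫ with h | h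
      · left; rw [h, sub_self]
      · right; rw [h, sub_self]
  rcases hcases with h | h
  · have h3 : T₃ = T₁ := (sub_eq_zero.1 h).symm
    obtain ⟨h4, hd⟩ := cmm_case s₁ p₁ s₂ s₄ hmin hmax h3
    rw [h3, h4, min_eq_left hd, max_eq_right hd]
    exact ⟨rfl, rfl⟩
  · have h3 : T₃ = T₂ := (sub_eq_zero.1 h).symm
    obtain ⟨h4, hd⟩ := cmm_case s₂ p₂ s₁ s₄ (fun v => (hmin v).trans (min_comm _ _))
      (fun v => (hmax v).trans (max_comm _ _)) h3
    rw [h3, h4, min_eq_right hd, max_eq_left hd]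
    exact ⟨rfl, rfl⟩
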